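/- If π is an A-minimal permutation and σ is a B-minimal permutation (for downsets A and B), then π ⊕ σ is (A ⊕ B)-minimal and π ⊖ σ is (A ⊖ B)-minimal. -/

import Mathlib

/-- The subsequence of `π` indexed by `S` is increasing. -/
def IsIncOn {n : ℕ} (π : Equiv.Perm (Fin n)) (S : Set (Fin n)) : Prop :=
  ∀ i ∈ S, ∀ j ∈ S, i < j → π i < π j

/-- The subsequence of `π` indexed by `S` is decreasing. -/
def IsDecOn {n : ℕ} (π : Equiv.Perm (Fin n)) (S : Set (Fin n)) : Prop :=
  ∀ i ∈ S, ∀ j ∈ S, i < j → π j < π i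

/-- `π` is `(r,s)`-coverable: its index set can be partitioned into `r` sets
indexing increasing subsequences and `s` sets indexing decreasing subsequences. -/
def Coverable {n : ℕ} (π : Equiv.Perm (Fin n)) (r s : ℕ) : Prop :=
  ∃ c : Fin n → Fin r ⊕ Fin s,
    (∀ a : Fin r, IsIncOn π {i | c i = Sum.inl a}) ∧
    (∀ b : Fin s, IsDecOn π {i | c i = Sum.inr b})

/-- `π` is `k`-coverable: `(r,s)`-coverable for some `r + s = k`. -/
def KCoverable {n : ℕ} (π : Equiv.Perm (Fin n)) (k : ℕ) : Prop :=
  ∃ r s, r + s = k ∧ Coverable π r s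

/-- `τ` is a pattern of `π`. -/
def Pattern {m n : ℕ} (τ : Equiv.Perm (Fin m)) (π : Equiv.Perm (Fin n)) : Prop :=
  ∃ f : Fin m → Fin n, StrictMono f ∧ ∀ i j, τ i < τ j ↔ π (f i) < π (f j)

/-- `τ` is a proper pattern of `π`. -/
def ProperPattern {m n : ℕ} (τ : Equiv.Perm (Fin m)) (π : Equiv.Perm (Fin n)) : Prop :=
  m < n ∧ Pattern τ π

/-- `π` is `(r,s)`-critical. -/
def RSCritical {n : ℕ} (π : Equiv.Perm (Fin n)) (r s : ℕ) : Prop :=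
  ¬ Coverable π r s ∧
    ∀ (m : ℕ) (τ : Equiv.Perm (Fin m)), ProperPattern τ π → Coverable τ r s

/-- `π` is `k`-critical. -/
def KCritical {n : ℕ} (π : Equiv.Perm (Fin n)) (k : ℕ) : Prop :=
  ¬ KCoverable π k ∧
    ∀ (m : ℕ) (τ : Equiv.Perm (Fin m)), ProperPattern τ π → KCoverable τ k

/-- `π` is `(r,s)`-sharp: `(r,s)`-critical and `(0,s+1)`-coverable. -/
def RSSharp {n : ℕ} (π : Equiv.Perm (Fin n)) (r s : ℕ) : Prop :=
  RSCritical π r s ∧ Coverable π 0 (s + 1)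

/-- `D(π)`: the set of pairs `(r,s)` such that `π` is not `(r,s)`-coverable. -/
def DSet {n : ℕ} (π : Equiv.Perm (Fin n)) : Set (ℕ × ℕ) :=
  {p | ¬ Coverable π p.1 p.2}

/-- A downset: a finite, downward-closed subset of `ℕ²`. -/
def IsDownset (A : Set (ℕ × ℕ)) : Prop :=
  A.Finite ∧ ∀ p ∈ A, ∀ q : ℕ × ℕ, q.1 ≤ p.1 → q.2 ≤ p.2 → q ∈ A

/-- `A ⊕ B` for subsets of `ℕ²`. -/
def setOplus (A B : Set (ℕ × ℕ)) : Set (ℕ × ℕ) :=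
  {p | ∀ s₁ s₂ : ℕ, s₁ + s₂ = p.2 → (p.1, s₁) ∈ A ∨ (p.1, s₂) ∈ B}

/-- `A ⊖ B` for subsets of `ℕ²`. -/
def setOminus (A B : Set (ℕ × ℕ)) : Set (ℕ × ℕ) :=
  {p | ∀ r₁ r₂ : ℕ, r₁ + r₂ = p.1 → (r₁, p.2) ∈ A ∨ (r₂, p.2) ∈ B}

/-- `π` is `A`-coverable. -/
def ACoverable {n : ℕ} (π : Equiv.Perm (Fin n)) (A : Set (ℕ × ℕ)) : Prop :=
  ∃ p ∈ A, Coverable π p.1 p.2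

/-- `π` is `A`-critical. -/
def ACritical {n : ℕ} (π : Equiv.Perm (Fin n)) (A : Set (ℕ × ℕ)) : Prop :=
  ¬ ACoverable π A ∧
    ∀ (m : ℕ) (τ : Equiv.Perm (Fin m)), ProperPattern τ π → ACoverable τ A

/-- `π` is `A`-minimal: `A`-critical with `D(π) = A`. -/
def AMinimal {n : ℕ} (π : Equiv.Perm (Fin n)) (A : Set (ℕ × ℕ)) : Prop :=
  ACritical π A ∧ DSet π = A

/-- The triangle `T(k) = {(r,s) : r + s ≤ k}`. -/
def T (k : ℕ) : Set (ℕ × ℕ) := {p | p.1 + p.2 ≤ k}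

/-- Direct sum of permutations: `π` followed by `σ` shifted up by `n`. -/
def directSum {n m : ℕ} (π : Equiv.Perm (Fin n)) (σ : Equiv.Perm (Fin m)) :
    Equiv.Perm (Fin (n + m)) :=
  finSumFinEquiv.symm.trans ((Equiv.sumCongr π σ).trans finSumFinEquiv)

/-- Skew sum of permutations: `π` shifted up by `m`, followed by `σ`. -/
def skewSum {n m : ℕ} (π : Equiv.Perm (Fin n)) (σ : Equiv.Perm (Fin m)) :
    Equiv.Perm (Fin (n + m)) :=
  finSumFinEquiv.symm.trans (((Equiv.sumCongr π σ).trans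
    (Equiv.sumComm (Fin n) (Fin m))).trans
    (finSumFinEquiv.trans (finCongr (Nat.add_comm m n))))

/-- Tensor product of permutations: `n` copies of `σ`, ordered like `π`. -/
def tensorProd {n m : ℕ} (π : Equiv.Perm (Fin n)) (σ : Equiv.Perm (Fin m)) :
    Equiv.Perm (Fin (n * m)) :=
  finProdFinEquiv.symm.trans ((Equiv.prodCongr π σ).trans finProdFinEquiv)

/-- A partial colouring, total on `S`, whose colour classes are `r` increasing and `s` decreasing
subsequences of `π`: the restriction of `π` to `S` is `(r,s)`-coverable. -/
def CoverableOn {n : ℕ} (π : Equiv.Perm (Fin n)) (S : Set (Fin n)) (r s : ℕ) : Prop :=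
  ∃ c : Fin n → Option (Fin r ⊕ Fin s), (∀ i ∈ S, ∃ y, c i = some y) ∧
    (∀ a : Fin r, IsIncOn π {i | c i = some (Sum.inl a)}) ∧
    (∀ b : Fin s, IsDecOn π {i | c i = some (Sum.inr b)})

theorem Coverable.coverableOn {n : ℕ} {π : Equiv.Perm (Fin n)} {r s : ℕ}
    (h : Coverable π r s) (S : Set (Fin n)) : CoverableOn π S r s := by
  obtain ⟨c, hi, hd⟩ := h
  exact ⟨fun i => some (c i), fun i _ => ⟨c i, rfl⟩, by simpa using hi, by simpa using hd⟩

/-- A pattern whose embedding lands in `S` inherits coverings of the restriction to `S`. -/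
theorem CoverableOn.coverable_of_embedding {k n : ℕ} {τ : Equiv.Perm (Fin k)}
    {π : Equiv.Perm (Fin n)} {S : Set (Fin n)} {r s : ℕ} (h : CoverableOn π S r s)
    {f : Fin k → Fin n} (hf : StrictMono f) (hτ : ∀ i j, τ i < τ j ↔ π (f i) < π (f j))
    (hS : ∀ i, f i ∈ S) : Coverable τ r s := by
  obtain ⟨c, hc, hi, hd⟩ := h
  choose g hg using fun i => hc (f i) (hS i)
  refine ⟨g, fun a i hi' j hj' hij => ?_, fun b i hi' j hj' hij => ?_⟩ <;>
    rw [Set.mem_ofPred_eq] at hi' hj'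
  · exact (hτ i j).2 (hi a _ (by simp [hg, hi']) _ (by simp [hg, hj']) (hf hij))
  · exact (hτ j i).2 (hd b _ (by simp [hg, hi']) _ (by simp [hg, hj']) (hf hij))

theorem coverableOn_univ {n : ℕ} (π : Equiv.Perm (Fin n)) (r s : ℕ) :
    CoverableOn π Set.univ r s ↔ Coverable π r s :=
  ⟨fun h => h.coverable_of_embedding strictMono_id (fun _ _ => Iff.rfl) fun _ => Set.mem_univ _,
    fun h => h.coverableOn _⟩

/-- The pattern of `π` obtained by deleting the entry at position `x`. -/
def deleteAt {k : ℕ} (π : Equiv.Perm (Fin (k + 1))) (x : Fin (k + 1)) : Equiv.Perm (Fin k) :=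
  (finSuccAboveEquiv x).trans
    ((π.subtypeEquiv fun i => by simp : {i // i ≠ x} ≃ {i // i ≠ π x}).trans
      (finSuccAboveEquiv (π x)).symm)

theorem succAbove_deleteAt {k : ℕ} (π : Equiv.Perm (Fin (k + 1))) (x : Fin (k + 1)) (i : Fin k) :
    (π x).succAbove (deleteAt π x i) = π (x.succAbove i) :=
  congrArg Subtype.val ((finSuccAboveEquiv (π x)).apply_symm_apply
    ((π.subtypeEquiv fun i => by simp : {i // i ≠ x} ≃ {i // i ≠ π x}) (finSuccAboveEquiv x i)))

theorem deleteAt_lt_iff {k : ℕ} (π : Equiv.Perm (Fin (k + 1))) (x : Fin (k + 1)) (i j : Fin k) :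
    deleteAt π x i < deleteAt π x j ↔ π (x.succAbove i) < π (x.succAbove j) := by
  rw [← succAbove_deleteAt, ← succAbove_deleteAt, Fin.succAbove_lt_succAbove_iff]

theorem properPattern_deleteAt {k : ℕ} (π : Equiv.Perm (Fin (k + 1))) (x : Fin (k + 1)) :
    ProperPattern (deleteAt π x) π :=
  ⟨k.lt_succ_self, x.succAbove, Fin.strictMono_succAbove x, deleteAt_lt_iff π x⟩

theorem coverableOn_compl_singleton_of_deleteAt {k : ℕ} {π : Equiv.Perm (Fin (k + 1))}
    {x : Fin (k + 1)} {r s : ℕ} (h : Coverable (deleteAt π x) r s) :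
    CoverableOn π {x}ᶜ r s := by
  obtain ⟨c, hi, hd⟩ := h
  refine ⟨x.insertNth (α := fun _ => Option (Fin r ⊕ Fin s)) none fun i => some (c i),
    fun i hx => ?_, fun a i hi' j hj' hij => ?_, fun b i hi' j hj' hij => ?_⟩
  · obtain ⟨i, rfl⟩ := Fin.exists_succAbove_eq hx
    exact ⟨c i, Fin.insertNth_apply_succAbove ..⟩
  all_goals
    rw [Set.mem_ofPred_eq] at hi' hj'
    obtain rfl | ⟨i, rfl⟩ := Fin.eq_self_or_eq_succAbove x i
    · simp at hi'
    obtain rfl | ⟨j, rfl⟩ := Fin.eq_self_or_eq_succAbove x j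
    · simp at hj'
    rw [Fin.insertNth_apply_succAbove, Option.some_inj] at hi' hj'
    rw [← deleteAt_lt_iff]
    rw [Fin.succAbove_lt_succAbove_iff] at hij
  · exact hi a i hi' j hj' hij
  · exact hd b i hi' j hj' hij

/-- Criticality only has to be tested on single-entry deletions. -/
theorem aMinimal_iff {n : ℕ} (π : Equiv.Perm (Fin n)) (A : Set (ℕ × ℕ)) :
    AMinimal π A ↔ DSet π = A ∧ ∀ x, ∃ p ∈ A, CoverableOn π {x}ᶜ p.1 p.2 := by
  constructor
  · rintro ⟨⟨-, h⟩, hD⟩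
    refine ⟨hD, fun x => ?_⟩
    rcases n with _ | k
    · exact x.elim0
    · obtain ⟨p, hp, hc⟩ := h _ _ (properPattern_deleteAt π x)
      exact ⟨p, hp, coverableOn_compl_singleton_of_deleteAt hc⟩
  · rintro ⟨hD, h⟩
    refine ⟨⟨fun ⟨p, hp, hc⟩ => (hD ▸ hp : p ∈ DSet π) hc, ?_⟩, hD⟩
    rintro k τ ⟨hk, f, hf, hτ⟩
    obtain ⟨x, hx⟩ : ∃ x, ∀ i, f i ≠ x := by
      by_contra! hsurj
      have := Fintype.card_le_of_surjective f hsurj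
      simp only [Fintype.card_fin] at this
      omega
    obtain ⟨p, hp, hc⟩ := h x
    exact ⟨p, hp, hc.coverable_of_embedding hf hτ hx⟩

section DirectSum

variable {n m : ℕ} (π : Equiv.Perm (Fin n)) (σ : Equiv.Perm (Fin m))

@[simp]
theorem directSum_castAdd (i : Fin n) :
    directSum π σ (Fin.castAdd m i) = Fin.castAdd m (π i) := by
  simp [directSum]

@[simp]
theorem directSum_natAdd (j : Fin m) :
    directSum π σ (Fin.natAdd n j) = Fin.natAdd n (σ j) := by
  simp [directSum]

@[simp]
theorem skewSum_castAdd (i : Fin n) :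
    skewSum π σ (Fin.castAdd m i) = Fin.cast (Nat.add_comm m n) (Fin.natAdd m (π i)) := by
  simp [skewSum]

@[simp]
theorem skewSum_natAdd (j : Fin m) :
    skewSum π σ (Fin.natAdd n j) = Fin.cast (Nat.add_comm m n) (Fin.castAdd n (σ j)) := by
  simp [skewSum]

variable {π σ}

theorem castAdd_lt_natAdd (i : Fin n) (j : Fin m) : Fin.castAdd m i < Fin.natAdd n j := by
  simp only [Fin.lt_def, Fin.val_castAdd, Fin.val_natAdd]
  omega

theorem CoverableOn.directSum {S : Set (Fin n)} {U : Set (Fin m)} {V : Set (Fin (n + m))}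
    {r s₁ s₂ : ℕ} (hπ : CoverableOn π S r s₁) (hσ : CoverableOn σ U r s₂)
    (hS : ∀ i, Fin.castAdd m i ∈ V → i ∈ S) (hU : ∀ j, Fin.natAdd n j ∈ V → j ∈ U) :
    CoverableOn (directSum π σ) V r (s₁ + s₂) := by
  obtain ⟨c, hc, hci, hcd⟩ := hπ
  obtain ⟨d, hd, hdi, hdd⟩ := hσ
  refine ⟨Fin.append (fun i => (c i).map (Sum.map id (Fin.castAdd s₂)))
    (fun j => (d j).map (Sum.map id (Fin.natAdd s₁))), fun i hi => ?_, fun a i hi j hj hij => ?_,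
    fun b i hi j hj hij => ?_⟩
  · induction i using Fin.addCases with
    | left i => obtain ⟨y, hy⟩ := hc i (hS i hi); simp [hy]
    | right j => obtain ⟨y, hy⟩ := hd j (hU j hi); simp [hy]
  · induction i using Fin.addCases with
    | left i =>
      induction j using Fin.addCases with
      | left j =>
        simp at hi hj hij ⊢
        exact hci a i hi j hj hij
      | right j => simpa using castAdd_lt_natAdd (π i) (σ j)
    | right i =>
      induction j using Fin.addCases with
      | left j => exact absurd hij (castAdd_lt_natAdd j i).not_gt
      | right j =>
        simp at hi hj hij ⊢
        exact hdi a i hi j hj hij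
  · induction i using Fin.addCases with
    | left i =>
      induction j using Fin.addCases with
      | left j =>
        simp at hi hj hij ⊢
        obtain ⟨b, hi, rfl⟩ := hi
        exact hcd b i hi j (by simpa using hj) hij
      | right j =>
        simp at hi hj
        obtain ⟨b, hi, rfl⟩ := hi
        obtain ⟨b', hj, h⟩ := hj
        simp [Fin.ext_iff] at h
        omega
    | right i =>
      induction j using Fin.addCases with
      | left j => exact absurd hij (castAdd_lt_natAdd j i).not_gt
      | right j =>
        simp at hi hj hij ⊢
        obtain ⟨b, hi, rfl⟩ := hi
        exact hdd b i hi j (by simpa using hj) hij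

/-- A covering remains one when its colours for decreasing subsequences are drawn from a set `K`
containing all those in use. -/
theorem coverable_card_of_colors_mem {r s : ℕ} {c : Fin n → Fin r ⊕ Fin s} {K : Finset (Fin s)}
    (hi : ∀ a : Fin r, IsIncOn π {i | c i = Sum.inl a})
    (hd : ∀ b : Fin s, IsDecOn π {i | c i = Sum.inr b})
    (hK : ∀ i b, c i = Sum.inr b → b ∈ K) : Coverable π r K.card := by
  have hlift : ∀ i, ∃ y, Sum.map id (fun b => (K.equivFin.symm b : Fin s)) y = c i := by
    intro i
    rcases h : c i with a | b
    · exact ⟨Sum.inl a, rfl⟩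
    · exact ⟨Sum.inr (K.equivFin ⟨b, hK i b h⟩), by simp⟩
  choose d hd' using hlift
  refine ⟨d, fun a i hai j haj => hi a i ?_ j ?_,
    fun b i hbi j hbj => hd (K.equivFin.symm b) i ?_ j ?_⟩ <;>
    rw [Set.mem_ofPred_eq] at * <;>
    simp only [← hd', *, Sum.map_inl, Sum.map_inr, id_eq]

theorem coverable_directSum_iff {r s : ℕ} :
    Coverable (directSum π σ) r s ↔
      ∃ s₁ s₂, s₁ + s₂ = s ∧ Coverable π r s₁ ∧ Coverable σ r s₂ := by
  classical
  constructor
  · rintro ⟨c, hi, hd⟩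
    let K : Finset (Fin s) := {b | ∃ i, c (Fin.castAdd m i) = Sum.inr b}
    refine ⟨K.card, Kᶜ.card, by simp [Finset.card_add_card_compl],
      coverable_card_of_colors_mem (c := fun i => c (Fin.castAdd m i)) ?_ ?_ ?_,
      coverable_card_of_colors_mem (c := fun j => c (Fin.natAdd n j)) ?_ ?_ ?_⟩
    · intro a i hai j haj hij
      simpa [(Fin.strictMono_castAdd m).lt_iff_lt] using
        hi a _ hai _ haj (Fin.strictMono_castAdd m hij)
    · intro b i hbi j hbj hij
      simpa [(Fin.strictMono_castAdd m).lt_iff_lt] using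
        hd b _ hbi _ hbj (Fin.strictMono_castAdd m hij)
    · intro i b h
      simpa [K] using ⟨i, h⟩
    · intro a i hai j haj hij
      simpa using hi a _ hai _ haj (by simpa using hij)
    · intro b i hbi j hbj hij
      simpa using hd b _ hbi _ hbj (by simpa using hij)
    · intro j b hj
      simp only [K, Finset.mem_compl, Finset.mem_filter_univ]
      rintro ⟨i, h⟩
      have := hd b _ h _ hj (castAdd_lt_natAdd i j)
      rw [directSum_castAdd, directSum_natAdd] at this
      exact this.not_gt (castAdd_lt_natAdd _ _)
  · rintro ⟨s₁, s₂, rfl, hπ, hσ⟩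
    rw [← coverableOn_univ] at *
    exact hπ.directSum hσ (fun _ _ => trivial) fun _ _ => trivial

theorem dSet_directSum : DSet (directSum π σ) = setOplus (DSet π) (DSet σ) := by
  ext ⟨r, s⟩
  simp only [DSet, setOplus, Set.mem_ofPred_eq, coverable_directSum_iff]
  push Not
  grind

end DirectSum

/-- In each row a finite set has a least non-member. -/
theorem exists_least_notMem {B : Set (ℕ × ℕ)} (hB : B.Finite) (r : ℕ) :
    ∃ s, (r, s) ∉ B ∧ ∀ t < s, (r, t) ∈ B := by
  classical
  have h : ∃ s, (r, s) ∉ B := by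
    by_contra! h
    exact Set.infinite_of_injective_forall_mem (Prod.mk_right_injective r) h hB
  exact ⟨Nat.find h, Nat.find_spec h, fun t ht => not_not.1 (Nat.find_min h ht)⟩

theorem AMinimal.directSum {n m : ℕ} {A B : Set (ℕ × ℕ)} (hA : IsDownset A) (hB : IsDownset B)
    {π : Equiv.Perm (Fin n)} {σ : Equiv.Perm (Fin m)} (hπ : AMinimal π A) (hσ : AMinimal σ B) :
    AMinimal (directSum π σ) (setOplus A B) := by
  rw [aMinimal_iff] at *
  obtain ⟨hDπ, hπ⟩ := hπ
  obtain ⟨hDσ, hσ⟩ := hσ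
  refine ⟨by rw [dSet_directSum, hDπ, hDσ], fun x => ?_⟩
  induction x using Fin.addCases with
  | left x =>
    obtain ⟨⟨r, s₁⟩, hp, hc⟩ := hπ x
    obtain ⟨s₂, hs₂, hlt⟩ := exists_least_notMem hB.1 r
    have hcov : Coverable σ r s₂ := by
      rw [← hDσ] at hs₂
      exact not_not.1 hs₂
    refine ⟨(r, s₁ + s₂), fun t₁ t₂ ht => ?_, hc.directSum (hcov.coverableOn Set.univ)
      (fun i hi => by simpa using hi) fun _ _ => trivial⟩
    rcases le_or_gt t₁ s₁ with h | h
    · exact .inl (hA.2 _ hp _ le_rfl h)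
    · exact .inr (hlt _ (by simp only at ht; omega))
  | right x =>
    obtain ⟨⟨r, s₂⟩, hp, hc⟩ := hσ x
    obtain ⟨s₁, hs₁, hlt⟩ := exists_least_notMem hA.1 r
    have hcov : Coverable π r s₁ := by
      rw [← hDπ] at hs₁
      exact not_not.1 hs₁
    refine ⟨(r, s₁ + s₂), fun t₁ t₂ ht => ?_, (hcov.coverableOn Set.univ).directSum hc
      (fun _ _ => trivial) fun i hi => by simpa using hi⟩
    rcases le_or_gt t₂ s₂ with h | h
    · exact .inr (hB.2 _ hp _ le_rfl h)
    · exact .inl (hlt _ (by simp only at ht; omega))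

section Complement

/-- The complement of `π`: values are reversed, exchanging increasing and decreasing. -/
def complement {n : ℕ} (π : Equiv.Perm (Fin n)) : Equiv.Perm (Fin n) :=
  π.trans Fin.revPerm

@[simp]
theorem complement_apply {n : ℕ} (π : Equiv.Perm (Fin n)) (i : Fin n) :
    complement π i = (π i).rev := rfl

@[simp]
theorem complement_complement {n : ℕ} (π : Equiv.Perm (Fin n)) :
    complement (complement π) = π := by
  ext; simp

theorem complement_skewSum {n m : ℕ} (π : Equiv.Perm (Fin n)) (σ : Equiv.Perm (Fin m)) :
    complement (skewSum π σ) = directSum (complement π) (complement σ) := by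
  ext i
  induction i using Fin.addCases with
  | left i => simp [Fin.val_rev]; omega
  | right j => simp [Fin.val_rev]; omega

variable {n : ℕ} {π : Equiv.Perm (Fin n)}

theorem CoverableOn.complement {S : Set (Fin n)} {r s : ℕ} (h : CoverableOn π S r s) :
    CoverableOn (complement π) S s r := by
  obtain ⟨c, hc, hi, hd⟩ := h
  refine ⟨fun i => (c i).map Sum.swap, fun i hS => ?_, fun a i hai j haj hij => ?_,
    fun b i hbi j hbj hij => ?_⟩
  · obtain ⟨y, hy⟩ := hc i hS
    simp [hy]
  · simpa using hd a i (by simpa using hai) j (by simpa using haj) hij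
  · simpa using hi b i (by simpa using hbi) j (by simpa using hbj) hij

theorem coverable_complement_iff {r s : ℕ} : Coverable (complement π) r s ↔ Coverable π s r := by
  simp only [← coverableOn_univ]
  exact ⟨fun h => by simpa using h.complement, fun h => h.complement⟩

theorem AMinimal.complement {A : Set (ℕ × ℕ)} (h : AMinimal π A) :
    AMinimal (complement π) (Prod.swap ⁻¹' A) := by
  rw [aMinimal_iff] at *
  refine ⟨?_, fun x => ?_⟩
  · rw [← h.1]
    ext p
    simp [DSet, coverable_complement_iff]
  · obtain ⟨p, hp, hc⟩ := h.2 x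
    exact ⟨p.swap, by simpa using hp, hc.complement⟩

theorem IsDownset.swap {A : Set (ℕ × ℕ)} (h : IsDownset A) : IsDownset (Prod.swap ⁻¹' A) :=
  ⟨h.1.preimage Prod.swap_injective.injOn, fun p hp _ h₁ h₂ => h.2 p.swap hp _ h₂ h₁⟩

end Complement

theorem AMinimal.skewSum {n m : ℕ} {A B : Set (ℕ × ℕ)} (hA : IsDownset A) (hB : IsDownset B)
    {π : Equiv.Perm (Fin n)} {σ : Equiv.Perm (Fin m)} (hπ : AMinimal π A) (hσ : AMinimal σ B) :
    AMinimal (skewSum π σ) (setOminus A B) := by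
  have h := (hπ.complement.directSum hA.swap hB.swap hσ.complement).complement
  rwa [← complement_skewSum, complement_complement] at h

/-- Lemma 5: sums of minimal permutations are minimal. -/
theorem minimal_sums {n m : ℕ} (A B : Set (ℕ × ℕ)) (hA : IsDownset A) (hB : IsDownset B)
    (π : Equiv.Perm (Fin n)) (σ : Equiv.Perm (Fin m))
    (hπ : AMinimal π A) (hσ : AMinimal σ B) :
    AMinimal (directSum π σ) (setOplus A B) ∧ AMinimal (skewSum π σ) (setOminus A B) := by
  exact ⟨hπ.directSum hA hB hσ, hπ.skewSum hA hB hσ⟩
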